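/- Let g_k(μ) denote the number of simplified vacillating tableaux of shape μ and semi-length k, i.e., walks of 2k steps on Young's lattice starting at the empty partition, where at each odd step one either does nothing or removes one box, and at each even step one either does nothing or adds one box, ending at μ. Then g_k(μ) = 0 unless |μ| ≤ k, and ∑_μ g_k(μ) · f^μ · C(n, |μ|) equals the number of n-restricted set partitions of {1,...,n+k} whenever n ≥ k. -/

import Mathlib

/-- The cells of the Young diagram with row-length multiset `M`. -/
def cells (M : Multiset ℕ) : Set (ℕ × ℕ) :=
  {p | p.1 < (M.filter (fun x => p.2 < x)).card}

/-- `fSYT i M`: the number of standard Young tableaux of the shape with `i`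
boxes and row lengths `M`. -/
noncomputable def fSYT (i : ℕ) (M : Multiset ℕ) : ℕ :=
  Nat.card {F : ℕ × ℕ → ℕ //
    (∀ p, p ∉ cells M → F p = 0) ∧
    Set.BijOn F (cells M) (Set.Iio i) ∧
    (∀ r c, (r, c + 1) ∈ cells M → F (r, c) < F (r, c + 1)) ∧
    (∀ r c, (r + 1, c) ∈ cells M → F (r, c) < F (r + 1, c))}

/-- A set partition of `{1,…,n+k}` is `n`-restricted if the first `n`
elements lie in pairwise distinct parts. -/
def Restricted (n k : ℕ) (P : Setoid (Fin (n + k))) : Prop :=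
  ∀ a b : Fin n, P.r (Fin.castAdd k a) (Fin.castAdd k b) → a = b

/-- A simplified vacillating tableau of semi-length `k`: a walk of `2k` steps
on Young's lattice starting at the empty partition, where at each odd step one
either does nothing or removes one box, and at each even step one either does
nothing or adds one box. -/
def IsSimplifiedVacillating (k : ℕ) (w : Fin (2 * k + 1) → YoungDiagram) : Prop :=
  w 0 = ⊥ ∧
  ∀ s : Fin (2 * k),
    if s.val % 2 = 0 then
      w s.succ ≤ w s.castSucc ∧ (w s.castSucc).card ≤ (w s.succ).card + 1
    else
      w s.castSucc ≤ w s.succ ∧ (w s.succ).card ≤ (w s.castSucc).card + 1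

/-- `gk k i p`: the number of simplified vacillating tableaux of semi-length
`k` and shape the partition `p` of `i`. -/
noncomputable def gk (k i : ℕ) (p : Nat.Partition i) : ℕ :=
  Nat.card {w : Fin (2 * k + 1) → YoungDiagram //
    IsSimplifiedVacillating k w ∧
    ((w (Fin.last (2 * k))).rowLens : Multiset ℕ) = p.parts}

/-- The setoids on `α ⊕ β` for which the elements of `α` are pairwise inequivalent. -/
def SeparatesLeft (α β : Type) (P : Setoid (α ⊕ β)) : Prop :=
  ∀ a b : α, P.r (Sum.inl a) (Sum.inl b) → a = b

/-- The number of setoids on `α ⊕ β` separating the elements of `α`. -/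
noncomputable def separatingCount (α β : Type) : ℕ :=
  Nat.card {P : Setoid (α ⊕ β) // SeparatesLeft α β P}

/-- Transport of setoids along an equivalence. -/
def Setoid.congrEquiv {γ δ : Type} (e : γ ≃ δ) : Setoid γ ≃ Setoid δ where
  toFun P := P.comap e.symm
  invFun P := P.comap e
  left_inv P := by ext a b; simp [Setoid.comap_rel]
  right_inv P := by ext a b; simp [Setoid.comap_rel]

instance Setoid.finite_of_finite {γ : Type} [Finite γ] : Finite (Setoid γ) :=
  Finite.of_injective (fun P : Setoid γ => fun a b => P.r a b) fun P Q h => by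
    ext a b
    exact iff_of_eq (congrFun (congrFun h a) b)

theorem separatingCount_congr {α α' β β' : Type} (e : α ≃ α') (e' : β ≃ β') :
    separatingCount α β = separatingCount α' β' := by
  refine Nat.card_congr ((Setoid.congrEquiv (e.sumCongr e')).subtypeEquiv fun P => ?_)
  constructor
  · intro h a b hab
    exact e.symm.injective (h _ _ hab)
  · intro h a b hab
    apply e.injective
    apply h
    change P.r _ _
    simpa using hab

theorem card_restricted_eq_separatingCount (n k : ℕ) :
    Nat.card {P : Setoid (Fin (n + k)) // Restricted n k P} =
      separatingCount (Fin n) (Fin k) := by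
  refine Nat.card_congr ((Setoid.congrEquiv finSumFinEquiv.symm).subtypeEquiv fun P => ?_)
  rfl

/-- Setoids on `δ` in which every point is equivalent to its image under the retraction `s ∘ r`
correspond to setoids on the retract. -/
def Setoid.retractEquiv {γ δ : Type} (s : γ → δ) (r : δ → γ) (hrs : ∀ x, r (s x) = x) :
    {P : Setoid δ // ∀ x, P.r (s (r x)) x} ≃ Setoid γ where
  toFun P := P.1.comap s
  invFun Q := ⟨Q.comap r, fun x => by
    change Q.r _ _
    rw [hrs]⟩
  left_inv P := by
    ext a b
    change P.1.r (s (r a)) (s (r b)) ↔ P.1.r a b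
    exact ⟨fun h => P.1.trans (P.1.symm (P.2 a)) (P.1.trans h (P.2 b)),
      fun h => P.1.trans (P.2 a) (P.1.trans h (P.1.symm (P.2 b)))⟩
  right_inv Q := by
    ext a b
    change Q.r (r (s a)) (r (s b)) ↔ Q.r a b
    rw [hrs, hrs]

theorem card_separating_joined {α β : Type} (a : α) :
    Nat.card {P : Setoid (α ⊕ Option β) //
      SeparatesLeft α (Option β) P ∧ P.r (Sum.inl a) (Sum.inr none)} = separatingCount α β := by
  let s : α ⊕ β → α ⊕ Option β := Sum.map id some
  let r : α ⊕ Option β → α ⊕ β := Sum.elim Sum.inl (fun o => o.elim (Sum.inl a) Sum.inr)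
  have hrs : ∀ x, r (s x) = x := by rintro (x | x) <;> rfl
  have key : ∀ P : Setoid (α ⊕ Option β),
      (∀ x, P.r (s (r x)) x) ↔ P.r (Sum.inl a) (Sum.inr none) := by
    intro P
    refine ⟨fun h => h (Sum.inr none), ?_⟩
    rintro h (x | _ | x)
    · exact P.refl _
    · exact h
    · exact P.refl _
  refine Nat.card_congr (Equiv.trans (Equiv.trans (Equiv.subtypeEquivRight fun P => ?_)
    (Equiv.subtypeSubtypeEquivSubtypeInter (fun P => ∀ x, P.r (s (r x)) x)
      (SeparatesLeft α (Option β))).symm)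
    ((Setoid.retractEquiv s r hrs).subtypeEquiv
      (p := fun P => SeparatesLeft α (Option β) P.1) (q := SeparatesLeft α β) fun P => Iff.rfl))
  rw [key, and_comm]

theorem card_separating_not_joined (α β : Type) :
    Nat.card {P : Setoid (α ⊕ Option β) //
      SeparatesLeft α (Option β) P ∧ ∀ a, ¬ P.r (Sum.inl a) (Sum.inr none)} =
      separatingCount (Option α) β := by
  let e : α ⊕ Option β ≃ Option α ⊕ β :=
    { toFun := Sum.elim (Sum.inl ∘ some) (fun o => o.elim (Sum.inl none) Sum.inr)
      invFun := Sum.elim (fun o => o.elim (Sum.inr none) Sum.inl) (Sum.inr ∘ some)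
      left_inv := by rintro (x | _ | x) <;> rfl
      right_inv := by rintro ((_ | x) | x) <;> rfl }
  refine Nat.card_congr ((Setoid.congrEquiv e).subtypeEquiv fun P => ?_)
  constructor
  · rintro ⟨h, h'⟩ (_ | a) (_ | b) hab
    · rfl
    · exact (h' b (P.symm hab)).elim
    · exact (h' a hab).elim
    · exact congrArg some (h a b hab)
  · intro h
    refine ⟨fun a b hab => Option.some_injective _ (h (some a) (some b) hab), fun a ha => ?_⟩
    exact Option.some_ne_none a (h (some a) none ha)

theorem separatingCount_option (α β : Type) [Fintype α] [Finite β] :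
    separatingCount α (Option β) =
      Fintype.card α * separatingCount α β + separatingCount (Option α) β := by
  classical
  let p : Setoid (α ⊕ Option β) → Prop := fun P => ∃ a, P.r (Sum.inl a) (Sum.inr none)
  have hsigma : Nat.card {P : Setoid (α ⊕ Option β) // SeparatesLeft α (Option β) P ∧ p P} =
      Fintype.card α * separatingCount α β := by
    let f : (Σ a : α, {P : Setoid (α ⊕ Option β) //
        SeparatesLeft α (Option β) P ∧ P.r (Sum.inl a) (Sum.inr none)}) →
        {P : Setoid (α ⊕ Option β) // SeparatesLeft α (Option β) P ∧ p P} :=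
      fun x => ⟨x.2.1, x.2.2.1, x.1, x.2.2.2⟩
    have hf : Function.Bijective f := by
      constructor
      · rintro ⟨a, P, hP, ha⟩ ⟨b, Q, hQ, hb⟩ h
        obtain rfl : P = Q := congrArg Subtype.val h
        obtain rfl : a = b := hP a b (P.trans ha (P.symm hb))
        rfl
      · rintro ⟨P, hP, a, ha⟩
        exact ⟨⟨a, P, hP, ha⟩, rfl⟩
    rw [← Nat.card_congr (Equiv.ofBijective f hf), Nat.card_sigma]
    simp [card_separating_joined]
  have hnot : Nat.card {P : Setoid (α ⊕ Option β) // SeparatesLeft α (Option β) P ∧ ¬ p P} =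
      separatingCount (Option α) β := by
    rw [← card_separating_not_joined]
    exact Nat.card_congr (Equiv.subtypeEquivRight fun P => by simp only [p, not_exists])
  rw [← hsigma, ← hnot, ← Nat.card_sum, separatingCount]
  exact Nat.card_congr <|
    (Equiv.sumCompl fun P : {P // SeparatesLeft α (Option β) P} => p P).symm.trans (Equiv.sumCongr
      (Equiv.subtypeSubtypeEquivSubtypeInter _ p)
      (Equiv.subtypeSubtypeEquivSubtypeInter _ fun P => ¬ p P))

theorem card_restricted_succ (n k : ℕ) :
    Nat.card {P : Setoid (Fin (n + (k + 1))) // Restricted n (k + 1) P} =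
      n * Nat.card {P : Setoid (Fin (n + k)) // Restricted n k P} +
        Nat.card {P : Setoid (Fin (n + 1 + k)) // Restricted (n + 1) k P} := by
  simp only [card_restricted_eq_separatingCount]
  rw [separatingCount_congr (Equiv.refl _) finSuccEquivLast, separatingCount_option,
    separatingCount_congr finSuccEquivLast (Equiv.refl (Fin k)), Fintype.card_fin]

theorem card_restricted_zero (n : ℕ) :
    Nat.card {P : Setoid (Fin (n + 0)) // Restricted n 0 P} = 1 := by
  rw [Nat.card_eq_one_iff_unique]
  refine ⟨⟨fun P Q => Subtype.ext (Setoid.ext fun a b => ?_)⟩,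
    ⟨⟨⊥, fun a b h => h⟩⟩⟩
  constructor
  · intro h
    obtain rfl := P.2 a b h
    exact Q.1.refl a
  · intro h
    obtain rfl := Q.2 a b h
    exact P.1.refl a

/-- Walks `a = w 0, …, w m = b` whose `s`-th step is constrained by `R s`. -/
def WalkSpace {α : Type} (R : ℕ → α → α → Prop) (a : α) (m : ℕ) (b : α) : Type :=
  {w : Fin (m + 1) → α // w 0 = a ∧ (∀ s : Fin m, R s.val (w s.castSucc) (w s.succ)) ∧
    w (Fin.last m) = b}

theorem WalkSpace.card_zero {α : Type} [DecidableEq α] (R : ℕ → α → α → Prop) (a b : α) :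
    Nat.card (WalkSpace R a 0 b) = if a = b then 1 else 0 := by
  split_ifs with h
  · subst h
    rw [Nat.card_eq_one_iff_unique]
    refine ⟨⟨fun w w' => Subtype.ext (funext fun i => ?_)⟩,
      ⟨⟨fun _ => a, rfl, fun s => s.elim0, rfl⟩⟩⟩
    obtain rfl : i = 0 := Fin.fin_one_eq_zero i
    exact w.2.1.trans w'.2.1.symm
  · have : IsEmpty (WalkSpace R a 0 b) := ⟨fun w => h (w.2.1.symm.trans w.2.2.2)⟩
    exact Nat.card_of_isEmpty

/-- Append a final step to a walk. -/
def WalkSpace.append {α : Type} (R : ℕ → α → α → Prop) (a : α) (m : ℕ) (b : α) (T : Finset α)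
    (hT : ∀ x, x ∈ T ↔ R m x b) (z : Σ x : T, WalkSpace R a m x.1) :
    WalkSpace R a (m + 1) b :=
  ⟨Fin.snoc (α := fun _ => α) z.2.1 b, by
    obtain ⟨⟨x, hx⟩, w, h0, hs, hl⟩ := z
    refine ⟨?_, fun s => ?_, Fin.snoc_last _ _⟩
    · exact (Fin.snoc_castSucc (α := fun _ => α) b w 0).trans h0
    · refine Fin.lastCases ?_ (fun s => ?_) s
      · rw [Fin.snoc_castSucc, Fin.succ_last, Fin.snoc_last]
        simp only [Fin.val_last, hl]
        exact (hT x).1 hx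
      · rw [Fin.snoc_castSucc, Fin.succ_castSucc, Fin.snoc_castSucc]
        exact hs s⟩

theorem WalkSpace.append_bijective {α : Type} (R : ℕ → α → α → Prop) (a : α) (m : ℕ) (b : α)
    (T : Finset α) (hT : ∀ x, x ∈ T ↔ R m x b) :
    Function.Bijective (WalkSpace.append R a m b T hT) := by
  constructor
  · rintro ⟨⟨x, hx⟩, w, h0, hs, hl⟩ ⟨⟨x', hx'⟩, w', h0', hs', hl'⟩ h
    obtain rfl : w = w' := by
      have h' : Fin.snoc (α := fun _ => α) w b = Fin.snoc (α := fun _ => α) w' b :=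
        congrArg Subtype.val h
      funext i
      have := congrFun h' i.castSucc
      simpa only [Fin.snoc_castSucc] using this
    dsimp only at hl hl'
    subst hl
    subst hl'
    rfl
  · rintro ⟨w, h0, hs, hl⟩
    refine ⟨⟨⟨w (Fin.last m).castSucc, (hT _).2 ?_⟩, fun i => w i.castSucc, h0, fun s => ?_, rfl⟩,
      Subtype.ext (funext fun i => ?_)⟩
    · have := hs (Fin.last m)
      rwa [Fin.succ_last, hl] at this
    · exact hs s.castSucc
    · refine Fin.lastCases ?_ (fun i => ?_) i
      · exact (Fin.snoc_last (α := fun _ => α) _ _).trans hl.symm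
      · exact Fin.snoc_castSucc (α := fun _ => α) _ _ _

theorem WalkSpace.finite {α : Type} (R : ℕ → α → α → Prop) (a : α)
    (hR : ∀ m b, {x | R m x b}.Finite) (m : ℕ) : ∀ b, Finite (WalkSpace R a m b) := by
  induction m with
  | zero =>
    intro b
    have : Subsingleton (WalkSpace R a 0 b) :=
      ⟨fun w w' => Subtype.ext (funext fun i => by
        obtain rfl : i = 0 := Fin.fin_one_eq_zero i
        exact w.2.1.trans w'.2.1.symm)⟩
    infer_instance
  | succ m ih =>
    intro b
    have hb := WalkSpace.append_bijective R a m b (hR m b).toFinset (by simp)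
    exact Finite.of_surjective _ hb.2

theorem WalkSpace.card_succ {α : Type} (R : ℕ → α → α → Prop) (a : α)
    (hR : ∀ m b, {x | R m x b}.Finite) (m : ℕ) (b : α) (T : Finset α)
    (hT : ∀ x, x ∈ T ↔ R m x b) :
    Nat.card (WalkSpace R a (m + 1) b) = ∑ x ∈ T, Nat.card (WalkSpace R a m x) := by
  have := WalkSpace.finite R a hR m
  rw [← Nat.card_congr (Equiv.ofBijective _ (WalkSpace.append_bijective R a m b T hT)),
    Nat.card_sigma, Finset.sum_coe_sort T fun x => Nat.card (WalkSpace R a m x)]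

namespace YoungDiagram

instance : DecidableLE YoungDiagram := fun μ ν =>
  inferInstanceAs (Decidable (μ.cells ⊆ ν.cells))

theorem fst_lt_card {μ : YoungDiagram} {p : ℕ × ℕ} (hp : p ∈ μ) : p.1 < μ.card := by
  have h : (Finset.range (p.1 + 1)).map ⟨fun i => (i, p.2), fun i j h => (Prod.ext_iff.1 h).1⟩ ⊆
      μ.cells := by
    intro q hq
    simp only [Finset.mem_map, Finset.mem_range] at hq
    obtain ⟨i, hi, rfl⟩ := hq
    exact μ.up_left_mem (Nat.lt_succ_iff.1 hi) le_rfl hp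
  simpa using Finset.card_le_card h

theorem snd_lt_card {μ : YoungDiagram} {p : ℕ × ℕ} (hp : p ∈ μ) : p.2 < μ.card := by
  have h : (Finset.range (p.2 + 1)).map ⟨fun j => (p.1, j), fun i j h => (Prod.ext_iff.1 h).2⟩ ⊆
      μ.cells := by
    intro q hq
    simp only [Finset.mem_map, Finset.mem_range] at hq
    obtain ⟨i, hi, rfl⟩ := hq
    exact μ.up_left_mem le_rfl (Nat.lt_succ_iff.1 hi) hp
  simpa using Finset.card_le_card h

theorem finite_card_le (n : ℕ) : {μ : YoungDiagram | μ.card ≤ n}.Finite := by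
  refine Set.Finite.of_finite_image (f := YoungDiagram.cells)
    (Set.Finite.subset (Finset.finite_toSet (Finset.range n ×ˢ Finset.range n).powerset) ?_)
    (fun μ _ ν _ h => YoungDiagram.ext h)
  rintro _ ⟨μ, hμ, rfl⟩
  simp only [Finset.coe_powerset, Set.mem_preimage, Set.mem_powerset_iff, Finset.coe_subset]
  intro p hp
  have hμ' : μ.card ≤ n := hμ
  exact Finset.mem_product.2 ⟨Finset.mem_range.2 ((fst_lt_card hp).trans_le hμ'),
    Finset.mem_range.2 ((snd_lt_card hp).trans_le hμ')⟩

instance : DecidableEq YoungDiagram := fun μ ν =>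
  decidable_of_iff (μ.cells = ν.cells) YoungDiagram.ext_iff.symm

/-- The Young diagrams with `n` boxes. -/
noncomputable def level (n : ℕ) : Finset YoungDiagram :=
  {μ ∈ (finite_card_le n).toFinset | μ.card = n}

@[simp]
theorem mem_level {n : ℕ} {μ : YoungDiagram} : μ ∈ level n ↔ μ.card = n := by
  simp +contextual [level]

theorem card_mono {μ ν : YoungDiagram} (h : μ ≤ ν) : μ.card ≤ ν.card :=
  Finset.card_le_card h

theorem eq_of_le_of_card_le {μ ν : YoungDiagram} (h : μ ≤ ν) (hc : ν.card ≤ μ.card) : μ = ν :=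
  YoungDiagram.ext (Finset.eq_of_subset_of_card_le h hc)

theorem card_sup_add_card_inf (μ ν : YoungDiagram) :
    (μ ⊔ ν).card + (μ ⊓ ν).card = μ.card + ν.card :=
  Finset.card_union_add_card_inter μ.cells ν.cells

theorem level_zero : level 0 = {⊥} := by
  ext μ
  rw [mem_level, Finset.mem_singleton, YoungDiagram.card, Finset.card_eq_zero]
  exact ⟨fun h => YoungDiagram.ext h, fun h => h ▸ rfl⟩

/-- If `μ` has one box more than `ν ≤ μ`, there is a unique box in the difference. -/
theorem exists_cells_eq_insert {μ ν : YoungDiagram} (h : ν ≤ μ) (hc : μ.card = ν.card + 1) :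
    ∃ p, p ∉ ν ∧ ∀ q, q ∈ μ ↔ q = p ∨ q ∈ ν := by
  have h1 : (μ.cells \ ν.cells).card = 1 := by
    rw [Finset.card_sdiff_of_subset h]
    change μ.card - ν.card = 1
    omega
  obtain ⟨p, hp⟩ := Finset.card_eq_one.1 h1
  have hmem : ∀ q, (q ∈ μ ∧ q ∉ ν) ↔ q = p := fun q => by
    rw [← Finset.mem_singleton, ← hp, Finset.mem_sdiff]
    rfl
  refine ⟨p, ((hmem p).2 rfl).2, fun q => ⟨fun hq => ?_, ?_⟩⟩
  · by_cases hν : q ∈ ν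
    · exact Or.inr hν
    · exact Or.inl ((hmem q).1 ⟨hq, hν⟩)
  · rintro (rfl | hq)
    · exact ((hmem q).2 rfl).1
    · exact h hq

/-- Rows from whose end a box may be removed. -/
def removableRows (μ : YoungDiagram) : Finset ℕ :=
  (Finset.range μ.card).filter fun r => μ.rowLen (r + 1) < μ.rowLen r

theorem mem_removableRows {μ : YoungDiagram} {r : ℕ} :
    r ∈ μ.removableRows ↔ μ.rowLen (r + 1) < μ.rowLen r := by
  rw [removableRows, Finset.mem_filter, Finset.mem_range, and_iff_right_iff_imp]
  intro h
  have : (r, 0) ∈ μ := mem_iff_lt_rowLen.2 (by omega)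
  exact fst_lt_card this

/-- Remove the last box of a removable row. -/
def eraseRow (μ : YoungDiagram) (r : ℕ) (h : r ∈ μ.removableRows) : YoungDiagram where
  cells := μ.cells.erase (r, μ.rowLen r - 1)
  isLowerSet := by
    rw [mem_removableRows] at h
    rintro ⟨a, b⟩ ⟨c, d⟩ ⟨hac, hbd⟩ hab
    dsimp only at hac hbd
    simp only [Finset.coe_erase, Set.mem_sdiff, Finset.mem_coe, mem_cells, Set.mem_singleton_iff,
      Prod.mk.injEq] at hab ⊢
    refine ⟨μ.up_left_mem hac hbd hab.1, ?_⟩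
    rintro ⟨rfl, rfl⟩
    obtain ⟨h1, h2⟩ := hab
    rw [mem_iff_lt_rowLen] at h1
    obtain rfl | hlt := hac.eq_or_lt
    · omega
    · have := μ.rowLen_anti (c + 1) a hlt
      omega

theorem card_eraseRow {μ : YoungDiagram} {r : ℕ} (h : r ∈ μ.removableRows) :
    (μ.eraseRow r h).card + 1 = μ.card := by
  refine Finset.card_erase_add_one ?_
  rw [mem_removableRows] at h
  exact mem_iff_lt_rowLen.2 (by omega)

theorem card_removableRows {μ : YoungDiagram} {n : ℕ} (hμ : μ.card = n + 1) :
    μ.removableRows.card = {ν ∈ level n | ν ≤ μ}.card := by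
  refine Finset.card_bij μ.eraseRow (fun r h => ?_) (fun r h r' h' e => ?_) (fun ν hν => ?_)
  · rw [Finset.mem_filter, mem_level]
    have := card_eraseRow h
    exact ⟨by omega, Finset.erase_subset _ _⟩
  · by_contra hne
    have h1 : (r, μ.rowLen r - 1) ∈ μ.eraseRow r' h' := by
      rw [mem_removableRows] at h
      refine Finset.mem_erase.2 ⟨fun e => hne (Prod.ext_iff.1 e).1, mem_iff_lt_rowLen.2 (by omega)⟩
    rw [← e] at h1
    exact Finset.notMem_erase _ _ h1
  · rw [Finset.mem_filter, mem_level] at hν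
    obtain ⟨⟨r, c⟩, hp, hμν⟩ := exists_cells_eq_insert hν.2 (by omega)
    have h1 : c < μ.rowLen r := mem_iff_lt_rowLen.1 ((hμν _).2 (Or.inl rfl))
    have h2 : ¬ c + 1 < μ.rowLen r := by
      rw [← mem_iff_lt_rowLen, hμν]
      rintro (h | h)
      · simp at h
      · exact hp (ν.up_left_mem le_rfl (Nat.le_succ c) h)
    have h3 : ¬ c < μ.rowLen (r + 1) := by
      rw [← mem_iff_lt_rowLen, hμν]
      rintro (h | h)
      · simp at h
      · exact hp (ν.up_left_mem (Nat.le_succ r) le_rfl h)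
    refine ⟨r, mem_removableRows.2 (by omega), YoungDiagram.ext (Finset.ext fun q => ?_)⟩
    have h4 : μ.rowLen r - 1 = c := by omega
    change q ∈ μ.cells.erase (r, μ.rowLen r - 1) ↔ q ∈ ν
    rw [Finset.mem_erase, mem_cells, hμν, h4]
    constructor
    · rintro ⟨h, h' | h'⟩
      · exact (h h').elim
      · exact h'
    · intro h
      exact ⟨fun e => hp (e ▸ h), Or.inr h⟩

/-- Rows to whose end a box may be added. -/
def addableRows (μ : YoungDiagram) : Finset ℕ :=
  insert 0 (μ.removableRows.image Nat.succ)

theorem card_addableRows (μ : YoungDiagram) :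
    μ.addableRows.card = μ.removableRows.card + 1 := by
  rw [addableRows, Finset.card_insert_of_notMem (by simp),
    Finset.card_image_of_injective _ Nat.succ_injective]

theorem mem_addableRows {μ : YoungDiagram} {r : ℕ} :
    r ∈ μ.addableRows ↔ ∀ s < r, μ.rowLen r < μ.rowLen s := by
  rw [addableRows, Finset.mem_insert, Finset.mem_image]
  constructor
  · rintro (rfl | ⟨a, ha, rfl⟩) s hs
    · omega
    · rw [mem_removableRows] at ha
      exact ha.trans_le (μ.rowLen_anti s a (Nat.lt_succ_iff.1 hs))
  · intro h
    cases r with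
    | zero => exact Or.inl rfl
    | succ r => exact Or.inr ⟨r, mem_removableRows.2 (h r r.lt_succ_self), rfl⟩

/-- Add a box at the end of an addable row. -/
def insertRow (μ : YoungDiagram) (r : ℕ) (h : r ∈ μ.addableRows) : YoungDiagram where
  cells := insert (r, μ.rowLen r) μ.cells
  isLowerSet := by
    rw [mem_addableRows] at h
    rintro ⟨a, b⟩ ⟨c, d⟩ ⟨hac, hbd⟩ hab
    dsimp only at hac hbd
    simp only [Finset.coe_insert, Set.mem_insert_iff, Finset.mem_coe, mem_cells,
      Prod.mk.injEq] at hab ⊢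
    obtain ⟨rfl, rfl⟩ | hab := hab
    · obtain rfl | hlt := hac.eq_or_lt
      · obtain rfl | hlt' := hbd.eq_or_lt
        · exact Or.inl ⟨rfl, rfl⟩
        · exact Or.inr (mem_iff_lt_rowLen.2 hlt')
      · exact Or.inr (mem_iff_lt_rowLen.2 (hbd.trans_lt (h c hlt)))
    · exact Or.inr (μ.up_left_mem hac hbd hab)

theorem card_insertRow {μ : YoungDiagram} {r : ℕ} (h : r ∈ μ.addableRows) :
    (μ.insertRow r h).card = μ.card + 1 := by
  refine Finset.card_insert_of_notMem fun h' => ?_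
  rw [mem_cells, mem_iff_lt_rowLen] at h'
  omega

theorem card_addableRows_eq {μ : YoungDiagram} {n : ℕ} (hμ : μ.card = n) :
    μ.addableRows.card = {ν ∈ level (n + 1) | μ ≤ ν}.card := by
  refine Finset.card_bij μ.insertRow (fun r h => ?_) (fun r h r' h' e => ?_) (fun ν hν => ?_)
  · rw [Finset.mem_filter, mem_level, card_insertRow, hμ]
    exact ⟨rfl, Finset.subset_insert _ _⟩
  · have h1 : (r, μ.rowLen r) ∈ μ.insertRow r h := Finset.mem_insert_self _ _
    rw [e] at h1
    obtain h1 | h1 := Finset.mem_insert.1 h1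
    · exact (Prod.ext_iff.1 h1).1
    · rw [mem_cells, mem_iff_lt_rowLen] at h1
      omega
  · rw [Finset.mem_filter, mem_level] at hν
    obtain ⟨⟨r, c⟩, hp, hνμ⟩ := exists_cells_eq_insert hν.2 (by omega)
    have hrc : (r, c) ∈ ν := (hνμ _).2 (Or.inl rfl)
    have h1 : ¬ c < μ.rowLen r := mem_iff_lt_rowLen.not.1 hp
    have h2 : μ.rowLen r = c := by
      obtain h | h := (hνμ (r, μ.rowLen r)).1 (ν.up_left_mem le_rfl (not_lt.1 h1) hrc)
      · exact (Prod.ext_iff.1 h).2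
      · exact absurd (mem_iff_lt_rowLen.1 h) (lt_irrefl _)
    have h3 : r ∈ μ.addableRows := by
      rw [mem_addableRows]
      intro s hs
      rw [h2, ← mem_iff_lt_rowLen]
      obtain h | h := (hνμ (s, c)).1 (ν.up_left_mem hs.le le_rfl hrc)
      · exact absurd (Prod.ext_iff.1 h).1 hs.ne
      · exact h
    refine ⟨r, h3, YoungDiagram.ext (Finset.ext fun q => ?_)⟩
    change q ∈ insert (r, μ.rowLen r) μ.cells ↔ q ∈ ν
    rw [Finset.mem_insert, hνμ, h2, mem_cells]

end YoungDiagram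

namespace YoungDiagram

theorem cells_rowLens (μ : YoungDiagram) : _root_.cells (μ.rowLens : Multiset ℕ) = μ.cells := by
  ext ⟨i, j⟩
  have h : ((μ.rowLens : Multiset ℕ).filter (fun x => j < x)).card = μ.colLen j := by
    rw [rowLens, ← Multiset.map_coe, Multiset.filter_map, Multiset.card_map, ← Multiset.range,
      ← Finset.range_val, ← Finset.filter_val, Finset.card_val]
    have : ({i ∈ Finset.range (μ.colLen 0) | ((fun x => j < x) ∘ μ.rowLen) i} : Finset ℕ) =
        Finset.range (μ.colLen j) := by
      ext i
      rw [Finset.mem_filter, Finset.mem_range, Finset.mem_range, Function.comp_apply,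
        ← mem_iff_lt_rowLen, ← mem_iff_lt_colLen, ← mem_iff_lt_colLen, and_iff_right_iff_imp]
      exact μ.up_left_mem le_rfl j.zero_le
    rw [this, Finset.card_range]
  change i < _ ↔ _
  rw [h, ← mem_iff_lt_colLen]
  rfl

/-- Standard fillings of a Young diagram, with entries `0, …, μ.card - 1` and value `0` outside. -/
def IsStandard (μ : YoungDiagram) (F : ℕ × ℕ → ℕ) : Prop :=
  (∀ p, p ∉ μ → F p = 0) ∧
    Set.BijOn F μ.cells (Set.Iio μ.card) ∧
    (∀ r c, (r, c + 1) ∈ μ → F (r, c) < F (r, c + 1)) ∧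
    (∀ r c, (r + 1, c) ∈ μ → F (r, c) < F (r + 1, c))

/-- The number of standard Young tableaux of shape `μ`. -/
noncomputable def numStandard (μ : YoungDiagram) : ℕ :=
  Nat.card {F : ℕ × ℕ → ℕ // IsStandard μ F}

theorem fSYT_rowLens (μ : YoungDiagram) :
    fSYT μ.card (μ.rowLens : Multiset ℕ) = μ.numStandard := by
  rw [fSYT, cells_rowLens]
  rfl

instance finite_isStandard (μ : YoungDiagram) : Finite {F : ℕ × ℕ → ℕ // IsStandard μ F} := by
  refine Finite.of_injective (β := μ.cells → Fin μ.card)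
    (fun F p => ⟨F.1 p.1, F.2.2.1.mapsTo p.2⟩) fun F G h => Subtype.ext (funext fun p => ?_)
  by_cases hp : p ∈ μ
  · exact congrArg Fin.val (congrFun h ⟨p, hp⟩)
  · rw [F.2.1 p hp, G.2.1 p hp]

theorem numStandard_bot : (⊥ : YoungDiagram).numStandard = 1 := by
  rw [numStandard, Nat.card_eq_one_iff_unique]
  refine ⟨⟨fun F G => Subtype.ext (funext fun p => ?_)⟩, ⟨⟨fun _ => 0, ?_⟩⟩⟩
  · rw [F.2.1 p (notMem_bot p), G.2.1 p (notMem_bot p)]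
  · refine ⟨fun _ _ => rfl, ?_, fun r c h => (notMem_bot _ h).elim,
      fun r c h => (notMem_bot _ h).elim⟩
    have h : Set.Iio (⊥ : YoungDiagram).card = ∅ := by
      ext x
      simp [YoungDiagram.card]
    rw [h]
    simp

theorem IsStandard.le {μ : YoungDiagram} {F : ℕ × ℕ → ℕ} (hF : IsStandard μ F) {p q : ℕ × ℕ}
    (hpq : p ≤ q) (hq : q ∈ μ) : F p ≤ F q := by
  obtain ⟨a, b⟩ := p
  obtain ⟨c, d⟩ := q
  obtain ⟨h1, h2⟩ := hpq
  dsimp only at h1 h2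
  have hrow : F (a, b) ≤ F (a, d) := by
    have had := μ.up_left_mem h1 le_rfl hq
    clear hq
    induction d, h2 using Nat.le_induction with
    | base => exact le_rfl
    | succ d _ ih =>
      exact (ih (μ.up_left_mem le_rfl d.le_succ had)).trans (hF.2.2.1 a d had).le
  refine hrow.trans ?_
  clear hrow
  induction c, h1 using Nat.le_induction with
  | base => exact le_rfl
  | succ c _ ih =>
    exact (ih (μ.up_left_mem c.le_succ le_rfl hq)).trans (hF.2.2.2 c d hq).le

/-- The diagram formed by the boxes with entries smaller than `n`. -/
def IsStandard.truncate {μ : YoungDiagram} {F : ℕ × ℕ → ℕ} (hF : IsStandard μ F) (n : ℕ) :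
    YoungDiagram where
  cells := {p ∈ μ.cells | F p < n}
  isLowerSet := by
    intro q p hpq hq
    rw [Finset.mem_coe, Finset.mem_filter] at hq ⊢
    exact ⟨μ.isLowerSet hpq hq.1, (hF.le hpq hq.1).trans_lt hq.2⟩

theorem IsStandard.mem_truncate {μ : YoungDiagram} {F : ℕ × ℕ → ℕ} (hF : IsStandard μ F) {n : ℕ}
    {p : ℕ × ℕ} : p ∈ hF.truncate n ↔ p ∈ μ ∧ F p < n :=
  Finset.mem_filter

theorem IsStandard.bijOn_truncate {μ : YoungDiagram} {F : ℕ × ℕ → ℕ} (hF : IsStandard μ F)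
    {n : ℕ} (hn : n ≤ μ.card) : Set.BijOn F (hF.truncate n).cells (Set.Iio n) := by
  refine ⟨fun p hp => (hF.mem_truncate.1 hp).2,
    hF.2.1.injOn.mono fun p hp => (hF.mem_truncate.1 hp).1, fun x hx => ?_⟩
  obtain ⟨p, hp, rfl⟩ := hF.2.1.surjOn (show x ∈ Set.Iio μ.card from lt_of_lt_of_le hx hn)
  exact ⟨p, hF.mem_truncate.2 ⟨hp, hx⟩, rfl⟩

theorem IsStandard.card_truncate {μ : YoungDiagram} {F : ℕ × ℕ → ℕ} (hF : IsStandard μ F)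
    {n : ℕ} (hn : n ≤ μ.card) : (hF.truncate n).card = n := by
  have h := hF.bijOn_truncate hn
  have h' : (hF.truncate n).cells.image F = Finset.range n := by
    rw [← Finset.coe_inj, Finset.coe_image, h.image_eq, Finset.coe_range]
  rw [YoungDiagram.card, ← Finset.card_image_of_injOn h.injOn, h', Finset.card_range]

/-- Extend a filling of `ν` to the diagram `μ` by the value `n`. -/
def extendFilling (μ ν : YoungDiagram) (n : ℕ) (F : ℕ × ℕ → ℕ) (p : ℕ × ℕ) : ℕ :=
  if p ∈ ν then F p else if p ∈ μ then n else 0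

theorem IsStandard.extend {μ ν : YoungDiagram} {n : ℕ} {F : ℕ × ℕ → ℕ} (hF : IsStandard ν F)
    (hμ : μ.card = n + 1) (hν : ν.card = n) (hle : ν ≤ μ) :
    IsStandard μ (extendFilling μ ν n F) := by
  obtain ⟨q, hq, hμν⟩ := exists_cells_eq_insert hle (by omega)
  have hlt : ∀ p ∈ ν, F p < n := fun p hp => hν ▸ hF.2.1.mapsTo hp
  have hin : ∀ p ∈ ν, extendFilling μ ν n F p = F p := fun p hp => if_pos hp
  have hqv : extendFilling μ ν n F q = n := by
    rw [extendFilling, if_neg hq, if_pos ((hμν q).2 (Or.inl rfl))]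
  have hmono : ∀ p p', p ≤ p' → p ≠ p' → p' ∈ μ → (p' ∈ ν → F p < F p') →
      extendFilling μ ν n F p < extendFilling μ ν n F p' := by
    intro p p' hpp hne hp' h
    obtain rfl | hp' := (hμν p').1 hp'
    · have hp : p ∈ ν := ((hμν p).1 (μ.isLowerSet hpp hp')).resolve_left hne
      rw [hqv, hin p hp]
      exact hlt p hp
    · rw [hin p' hp', hin p (ν.isLowerSet hpp hp')]
      exact h hp'
  refine ⟨fun p hp => ?_, ⟨fun p hp => ?_, fun p hp p' hp' h => ?_, fun x hx => ?_⟩, ?_, ?_⟩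
  · rw [extendFilling, if_neg (fun h => hp (hle h)), if_neg hp]
  · rw [Set.mem_Iio, hμ]
    obtain rfl | hp := (hμν p).1 hp
    · rw [hqv]
      exact n.lt_succ_self
    · rw [hin p hp]
      exact (hlt p hp).trans n.lt_succ_self
  · obtain rfl | hp := (hμν p).1 hp <;> obtain rfl | hp' := (hμν p').1 hp'
    · rfl
    · rw [hqv, hin p' hp'] at h
      exact absurd h (hlt p' hp').ne'
    · rw [hqv, hin p hp] at h
      exact absurd h (hlt p hp).ne
    · rw [hin p hp, hin p' hp'] at h
      exact hF.2.1.injOn hp hp' h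
  · rw [Set.mem_Iio, hμ, Nat.lt_succ_iff_lt_or_eq] at hx
    obtain hx | rfl := hx
    · obtain ⟨p, hp, rfl⟩ := hF.2.1.surjOn (show x ∈ Set.Iio ν.card from hν ▸ hx)
      exact ⟨p, hle hp, hin p hp⟩
    · exact ⟨q, (hμν q).2 (Or.inl rfl), hqv⟩
  · exact fun r c h => hmono _ _ (Prod.mk_le_mk.2 ⟨le_rfl, c.le_succ⟩) (by simp) h (hF.2.2.1 r c)
  · exact fun r c h => hmono _ _ (Prod.mk_le_mk.2 ⟨r.le_succ, le_rfl⟩) (by simp) h (hF.2.2.2 r c)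

/-- Removing the largest entry of a standard tableau. -/
theorem numStandard_eq_sum {μ : YoungDiagram} {n : ℕ} (hμ : μ.card = n + 1) :
    μ.numStandard = ∑ ν ∈ level n with ν ≤ μ, ν.numStandard := by
  have hT : ∀ ν : {ν // ν ∈ {ν ∈ level n | ν ≤ μ}}, ν.1.card = n ∧ ν.1 ≤ μ := fun ν => by
    obtain ⟨h1, h2⟩ := Finset.mem_filter.1 ν.2
    exact ⟨mem_level.1 h1, h2⟩
  let f : (Σ ν : {ν // ν ∈ {ν ∈ level n | ν ≤ μ}}, {F : ℕ × ℕ → ℕ // IsStandard ν.1 F}) →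
      {F : ℕ × ℕ → ℕ // IsStandard μ F} :=
    fun z => ⟨extendFilling μ z.1.1 n z.2.1, z.2.2.extend hμ (hT z.1).1 (hT z.1).2⟩
  have hf : Function.Bijective f := by
    constructor
    · rintro ⟨ν, F, hF⟩ ⟨ν', F', hF'⟩ h
      have h' : extendFilling μ ν n F = extendFilling μ ν' n F' := congrArg Subtype.val h
      have hmem : ∀ (ν : {ν // ν ∈ {ν ∈ level n | ν ≤ μ}}) (F : ℕ × ℕ → ℕ), IsStandard ν.1 F →
          ∀ p, p ∈ ν.1 ↔ p ∈ μ ∧ extendFilling μ ν n F p < n := by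
        intro ν F hF p
        by_cases hp : p ∈ ν.1
        · have : F p < n := (hT ν).1 ▸ hF.2.1.mapsTo hp
          simp [extendFilling, hp, this, (hT ν).2 hp]
        · by_cases hpμ : p ∈ μ <;> simp [extendFilling, hp, hpμ]
      obtain rfl : ν = ν' := Subtype.ext (YoungDiagram.ext (Finset.ext fun p => by
        rw [mem_cells, mem_cells, hmem ν F hF, hmem ν' F' hF', h']))
      obtain rfl : F = F' := funext fun p => by
        by_cases hp : p ∈ ν.1
        · simpa [extendFilling, hp] using congrFun h' p
        · rw [hF.1 p hp, hF'.1 p hp]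
      rfl
    · rintro ⟨F, hF⟩
      have hn : n ≤ μ.card := by omega
      have hle : hF.truncate n ≤ μ := Finset.filter_subset _ _
      have hval : ∀ p ∈ hF.truncate n, (if p ∈ hF.truncate n then F p else 0) = F p :=
        fun p hp => if_pos hp
      refine ⟨⟨⟨hF.truncate n, by simpa using ⟨hF.card_truncate hn, hle⟩⟩,
        fun p => if p ∈ hF.truncate n then F p else 0, fun p hp => if_neg hp, ?_,
        fun r c h => ?_, fun r c h => ?_⟩, Subtype.ext (funext fun p => ?_)⟩
      · dsimp only
        rw [hF.card_truncate hn]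
        exact (hF.bijOn_truncate hn).congr fun p hp => (hval p hp).symm
      · dsimp only
        rw [hval _ h, hval _ (up_left_mem _ le_rfl c.le_succ h)]
        exact hF.2.2.1 r c (hle h)
      · dsimp only
        rw [hval _ h, hval _ (up_left_mem _ r.le_succ le_rfl h)]
        exact hF.2.2.2 r c (hle h)
      · change extendFilling μ (hF.truncate n) n _ p = F p
        unfold extendFilling
        split_ifs with h1 h2
        · exact hval p h1
        · have h3 : F p < n + 1 := hμ ▸ hF.2.1.mapsTo h2
          have h4 : ¬ F p < n := fun h => h1 (hF.mem_truncate.2 ⟨h2, h⟩)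
          omega
        · exact (hF.1 p h2).symm
  rw [numStandard, ← Nat.card_congr (Equiv.ofBijective f hf), Nat.card_sigma]
  exact Finset.sum_coe_sort {ν ∈ level n | ν ≤ μ} numStandard

theorem card_common_covers {μ ρ : YoungDiagram} {n : ℕ} (hμ : μ.card = n + 1)
    (hρ : ρ.card = n + 1) :
    {ν ∈ level (n + 2) | μ ≤ ν ∧ ρ ≤ ν}.card =
      {σ ∈ level n | σ ≤ μ ∧ σ ≤ ρ}.card + if μ = ρ then 1 else 0 := by
  by_cases h : μ = ρ
  · subst h
    simp only [and_self, if_true]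
    rw [← card_addableRows_eq hμ, ← card_removableRows hμ, card_addableRows]
  rw [if_neg h, add_zero]
  have hsum := card_sup_add_card_inf μ ρ
  have hsup : n + 1 < (μ ⊔ ρ).card := by
    by_contra hlt
    have h1 := eq_of_le_of_card_le (le_sup_left : μ ≤ μ ⊔ ρ) (by omega)
    have h2 := eq_of_le_of_card_le (le_sup_right : ρ ≤ μ ⊔ ρ) (by omega)
    exact h (h1.trans h2.symm)
  by_cases hc : (μ ⊔ ρ).card = n + 2
  · have h1 : {ν ∈ level (n + 2) | μ ≤ ν ∧ ρ ≤ ν} = ({μ ⊔ ρ} : Finset YoungDiagram) := by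
      ext ν
      rw [Finset.mem_filter, mem_level, Finset.mem_singleton, ← sup_le_iff]
      constructor
      · rintro ⟨hν, hle⟩
        exact (eq_of_le_of_card_le hle (by omega)).symm
      · rintro rfl
        exact ⟨hc, le_rfl⟩
    have h2 : {σ ∈ level n | σ ≤ μ ∧ σ ≤ ρ} = ({μ ⊓ ρ} : Finset YoungDiagram) := by
      ext σ
      rw [Finset.mem_filter, mem_level, Finset.mem_singleton, ← le_inf_iff]
      constructor
      · rintro ⟨hσ, hle⟩
        exact eq_of_le_of_card_le hle (by omega)
      · rintro rfl
        exact ⟨by omega, le_rfl⟩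
    rw [h1, h2]
    rfl
  · rw [Finset.card_eq_zero.2, Finset.card_eq_zero.2]
    · refine Finset.filter_eq_empty_iff.2 fun σ hσ hle => ?_
      rw [mem_level] at hσ
      have := card_mono (le_inf hle.1 hle.2)
      omega
    · refine Finset.filter_eq_empty_iff.2 fun ν hν hle => ?_
      rw [mem_level] at hν
      have := card_mono (sup_le hle.1 hle.2)
      omega

theorem numStandard_of_card_eq_one {μ : YoungDiagram} (hμ : μ.card = 1) : μ.numStandard = 1 := by
  have : ({ν ∈ level 0 | ν ≤ μ} : Finset YoungDiagram) = {⊥} := by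
    rw [level_zero, Finset.filter_singleton, if_pos bot_le]
  rw [numStandard_eq_sum hμ, this, Finset.sum_singleton, numStandard_bot]

theorem sum_covers_numStandard (n : ℕ) : ∀ μ : YoungDiagram, μ.card = n →
    ∑ ν ∈ level (n + 1) with μ ≤ ν, ν.numStandard = (n + 1) * μ.numStandard := by
  induction n with
  | zero =>
    intro μ hμ
    have hbot : μ = ⊥ := by rwa [← mem_level, level_zero, Finset.mem_singleton] at hμ
    rw [Finset.sum_congr rfl fun ν hν =>
      numStandard_of_card_eq_one (mem_level.1 (Finset.mem_filter.1 hν).1), Finset.sum_const,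
      ← card_addableRows_eq hμ, card_addableRows, hbot, numStandard_bot]
    have : (⊥ : YoungDiagram).removableRows = ∅ := rfl
    rw [this]
    rfl
  | succ n ih =>
    intro μ hμ
    have h1 : ∑ ν ∈ level (n + 2) with μ ≤ ν, ν.numStandard =
        ∑ ρ ∈ level (n + 1), {ν ∈ level (n + 2) | μ ≤ ν ∧ ρ ≤ ν}.card * ρ.numStandard := by
      rw [Finset.sum_congr rfl fun ν hν =>
        numStandard_eq_sum (mem_level.1 (Finset.mem_filter.1 hν).1)]
      simp only [Finset.sum_filter (fun ρ => ρ ≤ _)]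
      rw [Finset.sum_comm]
      refine Finset.sum_congr rfl fun ρ _ => ?_
      rw [← Finset.sum_filter, Finset.filter_filter, Finset.sum_const, smul_eq_mul]
    have h2 : ∑ ρ ∈ level (n + 1), {σ ∈ level n | σ ≤ μ ∧ σ ≤ ρ}.card * ρ.numStandard =
        ∑ σ ∈ level n with σ ≤ μ, (n + 1) * σ.numStandard := by
      rw [Finset.sum_congr rfl fun σ hσ =>
        (ih σ (mem_level.1 (Finset.mem_filter.1 hσ).1)).symm]
      simp only [Finset.sum_filter (fun ρ => _ ≤ ρ)]
      rw [Finset.sum_comm]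
      refine Finset.sum_congr rfl fun ρ _ => ?_
      rw [← Finset.sum_filter, Finset.filter_filter, Finset.sum_const, smul_eq_mul]
    rw [h1, Finset.sum_congr rfl fun ρ hρ => by
      rw [card_common_covers hμ (mem_level.1 hρ), add_mul], Finset.sum_add_distrib, h2,
      ← Finset.mul_sum, ← numStandard_eq_sum hμ]
    simp only [ite_mul, one_mul, zero_mul]
    rw [Finset.sum_ite_eq, if_pos (mem_level.2 hμ)]
    ring

end YoungDiagram

namespace YoungDiagram

/-- The steps of simplified vacillating tableaux: even-indexed steps remove at most one box, and
odd-indexed steps add at most one box. -/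
def VacillatingStep (s : ℕ) (μ ν : YoungDiagram) : Prop :=
  if s % 2 = 0 then ν ≤ μ ∧ μ.card ≤ ν.card + 1 else μ ≤ ν ∧ ν.card ≤ μ.card + 1

/-- The number of walks of length `m` from the empty diagram to `μ` made of such steps. -/
noncomputable def numWalks (m : ℕ) (μ : YoungDiagram) : ℕ :=
  Nat.card (WalkSpace VacillatingStep ⊥ m μ)

theorem finite_vacillatingStep (s : ℕ) (ν : YoungDiagram) :
    {μ | VacillatingStep s μ ν}.Finite := by
  refine (finite_card_le (ν.card + 1)).subset fun μ h => ?_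
  rw [Set.mem_ofPred_eq, VacillatingStep] at h
  split_ifs at h
  · exact h.2
  · exact (card_mono h.1).trans (Nat.le_succ _)

theorem numWalks_succ_of_even {m : ℕ} (hm : m % 2 = 0) (ν : YoungDiagram) :
    numWalks (m + 1) ν = numWalks m ν + ∑ μ ∈ level (ν.card + 1) with ν ≤ μ, numWalks m μ := by
  have hν : ν ∉ ({μ ∈ level (ν.card + 1) | ν ≤ μ} : Finset YoungDiagram) := by simp
  rw [← Finset.sum_insert hν]
  refine WalkSpace.card_succ _ _ finite_vacillatingStep m ν _ fun μ => ?_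
  rw [VacillatingStep, if_pos hm, Finset.mem_insert, Finset.mem_filter, mem_level]
  constructor
  · rintro (rfl | ⟨h1, h2⟩)
    · exact ⟨le_rfl, Nat.le_succ _⟩
    · exact ⟨h2, h1.le⟩
  · rintro ⟨h1, h2⟩
    by_cases h : μ.card ≤ ν.card
    · exact Or.inl (eq_of_le_of_card_le h1 h).symm
    · exact Or.inr ⟨by omega, h1⟩

theorem numWalks_succ_of_odd {m n : ℕ} (hm : m % 2 = 1) {ν : YoungDiagram}
    (hn : ν.card = n + 1) :
    numWalks (m + 1) ν = numWalks m ν + ∑ μ ∈ level n with μ ≤ ν, numWalks m μ := by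
  have hν : ν ∉ ({μ ∈ level n | μ ≤ ν} : Finset YoungDiagram) := by simp [hn]
  rw [← Finset.sum_insert hν]
  refine WalkSpace.card_succ _ _ finite_vacillatingStep m ν _ fun μ => ?_
  rw [VacillatingStep, if_neg (by omega), Finset.mem_insert, Finset.mem_filter, mem_level]
  constructor
  · rintro (rfl | ⟨h1, h2⟩)
    · exact ⟨le_rfl, Nat.le_succ _⟩
    · exact ⟨h2, by omega⟩
  · rintro ⟨h1, h2⟩
    by_cases h : ν.card ≤ μ.card
    · exact Or.inl (eq_of_le_of_card_le h1 h)
    · exact Or.inr ⟨by omega, h1⟩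

theorem numWalks_succ_bot_of_odd {m : ℕ} (hm : m % 2 = 1) :
    numWalks (m + 1) ⊥ = numWalks m ⊥ := by
  rw [← Finset.sum_singleton (numWalks m) ⊥]
  refine WalkSpace.card_succ _ _ finite_vacillatingStep m ⊥ _ fun μ => ?_
  rw [VacillatingStep, if_neg (by omega), Finset.mem_singleton]
  exact ⟨fun h => h ▸ ⟨le_rfl, Nat.le_succ _⟩, fun h => le_bot_iff.1 h.1⟩

/-- The number of walks to diagrams with `i` boxes, weighted by the numbers of standard tableaux. -/
noncomputable def weightedWalks (m i : ℕ) : ℕ :=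
  ∑ μ ∈ level i, numWalks m μ * μ.numStandard

theorem weightedWalks_succ_of_even {m : ℕ} (hm : m % 2 = 0) (i : ℕ) :
    weightedWalks (m + 1) i = weightedWalks m i + weightedWalks m (i + 1) := by
  have h : ∀ ν ∈ level i, numWalks (m + 1) ν * ν.numStandard =
      numWalks m ν * ν.numStandard +
        ∑ μ ∈ level (i + 1), if ν ≤ μ then numWalks m μ * ν.numStandard else 0 := by
    intro ν hν
    rw [numWalks_succ_of_even hm, mem_level.1 hν, add_mul, Finset.sum_mul, Finset.sum_filter]
  rw [weightedWalks, Finset.sum_congr rfl h, Finset.sum_add_distrib, Finset.sum_comm]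
  refine congrArg _ (Finset.sum_congr rfl fun μ hμ => ?_)
  rw [numStandard_eq_sum (mem_level.1 hμ), Finset.mul_sum, Finset.sum_filter]

theorem weightedWalks_succ_zero_of_odd {m : ℕ} (hm : m % 2 = 1) :
    weightedWalks (m + 1) 0 = weightedWalks m 0 := by
  rw [weightedWalks, weightedWalks, level_zero, Finset.sum_singleton, Finset.sum_singleton,
    numWalks_succ_bot_of_odd hm]

theorem weightedWalks_succ_succ_of_odd {m : ℕ} (hm : m % 2 = 1) (i : ℕ) :
    weightedWalks (m + 1) (i + 1) = weightedWalks m (i + 1) + (i + 1) * weightedWalks m i := by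
  have h : ∀ ν ∈ level (i + 1), numWalks (m + 1) ν * ν.numStandard =
      numWalks m ν * ν.numStandard +
        ∑ μ ∈ level i, if μ ≤ ν then numWalks m μ * ν.numStandard else 0 := by
    intro ν hν
    rw [numWalks_succ_of_odd hm (mem_level.1 hν), add_mul, Finset.sum_mul, Finset.sum_filter]
  rw [weightedWalks, Finset.sum_congr rfl h, Finset.sum_add_distrib, Finset.sum_comm,
    weightedWalks, weightedWalks, Finset.mul_sum (level i)]
  refine congrArg _ (Finset.sum_congr rfl fun μ hμ => ?_)
  rw [← Finset.sum_filter, ← Finset.mul_sum, sum_covers_numStandard i μ (mem_level.1 hμ)]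
  ring

theorem card_le_of_walk {m : ℕ} {μ : YoungDiagram} (w : WalkSpace VacillatingStep ⊥ m μ)
    (s : Fin (m + 1)) : (w.1 s).card ≤ s.val / 2 := by
  induction s using Fin.induction with
  | zero =>
    rw [w.2.1]
    exact Nat.zero_le _
  | succ s ih =>
    have h := w.2.2.1 s
    rw [Fin.val_castSucc] at ih
    rw [Fin.val_succ]
    rw [VacillatingStep] at h
    split_ifs at h
    · have := card_mono h.1
      omega
    · omega

theorem numWalks_eq_zero {k : ℕ} {μ : YoungDiagram} (h : k < μ.card) : numWalks (2 * k) μ = 0 := by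
  have : IsEmpty (WalkSpace VacillatingStep ⊥ (2 * k) μ) := ⟨fun w => by
    have hw := card_le_of_walk w (Fin.last (2 * k))
    rw [w.2.2.2, Fin.val_last] at hw
    omega⟩
  exact Nat.card_of_isEmpty

theorem weightedWalks_eq_zero {k i : ℕ} (h : k < i) : weightedWalks (2 * k) i = 0 :=
  Finset.sum_eq_zero fun μ hμ => by
    rw [numWalks_eq_zero (by rwa [mem_level.1 hμ]), zero_mul]

theorem succ_mul_choose_succ_add (n i : ℕ) :
    (i + 1) * n.choose (i + 1) + i * n.choose i = n * n.choose i := by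
  obtain h | h := le_or_gt i n
  · rw [mul_comm, Nat.choose_succ_right_eq, mul_comm, ← add_mul, Nat.sub_add_cancel h]
  · simp [Nat.choose_eq_zero_of_lt h, Nat.choose_eq_zero_of_lt (h.trans i.lt_succ_self)]

/-- The effect on a binomial sum of a removal step followed by an addition step. -/
theorem sum_choose_step (n k : ℕ) (a b c : ℕ → ℕ) (ha : ∀ i, k < i → a i = 0)
    (hb : ∀ i, b i = a i + a (i + 1)) (hc0 : c 0 = b 0)
    (hc : ∀ i, c (i + 1) = b (i + 1) + (i + 1) * b i) :
    ∑ i ∈ Finset.range (k + 2), c i * n.choose i =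
      n * ∑ i ∈ Finset.range (k + 1), a i * n.choose i +
        ∑ i ∈ Finset.range (k + 1), a i * (n + 1).choose i := by
  have hak : a (k + 1) = 0 := ha _ (by omega)
  have hak' : a (k + 1 + 1) = 0 := ha _ (by omega)
  have h1 : ∑ i ∈ Finset.range (k + 2), c i * n.choose i =
      ∑ i ∈ Finset.range (k + 2), b i * n.choose i +
        ∑ i ∈ Finset.range (k + 1), (i + 1) * b i * n.choose (i + 1) := by
    rw [Finset.sum_range_succ', Finset.sum_range_succ' (fun i => b i * n.choose i), hc0,
      add_right_comm, ← Finset.sum_add_distrib]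
    simp only [hc, add_mul]
  have h2 : ∑ i ∈ Finset.range (k + 2), b i * n.choose i =
      ∑ i ∈ Finset.range (k + 1), a i * n.choose i +
        ∑ i ∈ Finset.range (k + 1), a (i + 1) * n.choose i := by
    rw [Finset.sum_range_succ, hb (k + 1), hak, hak', ← Finset.sum_add_distrib]
    simp only [hb, add_mul, add_zero, zero_mul]
  have h3 : ∑ i ∈ Finset.range (k + 1), a i * (n + 1).choose i =
      ∑ i ∈ Finset.range (k + 1), a i * n.choose i +
        ∑ i ∈ Finset.range (k + 1), a (i + 1) * n.choose i := by
    have e1 : ∀ m : ℕ, ∑ i ∈ Finset.range (k + 1), a i * m.choose i =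
        ∑ i ∈ Finset.range (k + 1), a (i + 1) * m.choose (i + 1) + a 0 := by
      intro m
      have := Finset.sum_range_succ' (fun i => a i * m.choose i) (k + 1)
      rw [Finset.sum_range_succ, hak] at this
      simpa using this
    rw [e1, e1 n, add_right_comm, ← Finset.sum_add_distrib]
    refine congrArg (· + a 0) (Finset.sum_congr rfl fun i _ => ?_)
    rw [Nat.choose_succ_succ]
    ring
  have h4 : ∑ i ∈ Finset.range (k + 1), (i + 1) * b i * n.choose (i + 1) =
      n * ∑ i ∈ Finset.range (k + 1), a i * n.choose i := by
    have e1 : ∑ i ∈ Finset.range (k + 1), a i * (i * n.choose i) =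
        ∑ i ∈ Finset.range (k + 1), a (i + 1) * ((i + 1) * n.choose (i + 1)) := by
      have := Finset.sum_range_succ' (fun i => a i * (i * n.choose i)) (k + 1)
      rw [Finset.sum_range_succ, hak] at this
      simpa using this
    calc _ = ∑ i ∈ Finset.range (k + 1), a i * ((i + 1) * n.choose (i + 1)) +
          ∑ i ∈ Finset.range (k + 1), a (i + 1) * ((i + 1) * n.choose (i + 1)) := by
          rw [← Finset.sum_add_distrib]
          refine Finset.sum_congr rfl fun i _ => ?_
          rw [hb]
          ring
      _ = _ := by
          rw [← e1, ← Finset.sum_add_distrib, Finset.mul_sum]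
          refine Finset.sum_congr rfl fun i _ => ?_
          rw [← mul_add, succ_mul_choose_succ_add]
          ring
  rw [h1, h2, h3, h4]
  ring

theorem weightedWalks_zero (i : ℕ) : weightedWalks 0 i = if i = 0 then 1 else 0 := by
  split_ifs with h
  · subst h
    rw [weightedWalks, level_zero, Finset.sum_singleton, numWalks, WalkSpace.card_zero,
      numStandard_bot, if_pos rfl]
  · exact weightedWalks_eq_zero (k := 0) (Nat.pos_of_ne_zero h)

theorem sum_weightedWalks_mul_choose (k : ℕ) : ∀ n : ℕ,
    ∑ i ∈ Finset.range (k + 1), weightedWalks (2 * k) i * n.choose i =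
      Nat.card {P : Setoid (Fin (n + k)) // Restricted n k P} := by
  induction k with
  | zero =>
    intro n
    rw [card_restricted_zero]
    simp [weightedWalks_zero]
  | succ k ih =>
    intro n
    rw [card_restricted_succ, ← ih, ← ih]
    have hodd : (2 * k + 1) % 2 = 1 := by omega
    exact sum_choose_step n k _ (weightedWalks (2 * k + 1)) _
      (fun i => weightedWalks_eq_zero)
      (weightedWalks_succ_of_even (by omega))
      (weightedWalks_succ_zero_of_odd hodd)
      (weightedWalks_succ_succ_of_odd hodd)

theorem sum_rowLens (μ : YoungDiagram) : μ.rowLens.sum = μ.card := by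
  have h : μ.cells = (Finset.range (μ.colLen 0)).biUnion μ.row := by
    ext ⟨i, j⟩
    simp only [Finset.mem_biUnion, Finset.mem_range, mem_row_iff, mem_cells,
      ← mem_iff_lt_colLen]
    constructor
    · exact fun h => ⟨i, μ.up_left_mem le_rfl j.zero_le h, h, rfl⟩
    · rintro ⟨_, _, h, _⟩
      exact h
  rw [YoungDiagram.card, h, Finset.card_biUnion, rowLens, ← List.sum_toFinset _ List.nodup_range,
    List.toFinset_range]
  · simp only [rowLen_eq_card]
  · intro i _ i' _ hne
    refine Finset.disjoint_left.2 fun p hp hp' => hne ?_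
    exact (mem_row_iff.1 hp).2.symm.trans (mem_row_iff.1 hp').2

/-- The partition formed by the row lengths of a Young diagram. -/
def toPartition {n : ℕ} (μ : YoungDiagram) (h : μ.card = n) : Nat.Partition n where
  parts := μ.rowLens
  parts_pos hi := μ.pos_of_mem_rowLens _ (Multiset.mem_coe.1 hi)
  parts_sum := by rw [Multiset.sum_coe, sum_rowLens, h]

theorem coe_rowLens_injective {μ ν : YoungDiagram}
    (h : (μ.rowLens : Multiset ℕ) = ν.rowLens) : μ = ν := by
  have h' : μ.rowLens = ν.rowLens :=
    (Multiset.coe_eq_coe.1 h).eq_of_sortedGE μ.rowLens_sorted ν.rowLens_sorted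
  exact equivListRowLens.injective (Subtype.ext h')

theorem exists_rowLens_eq {n : ℕ} (p : Nat.Partition n) :
    ∃ μ : YoungDiagram, μ.card = n ∧ (μ.rowLens : Multiset ℕ) = p.parts := by
  have hs : (p.parts.sort (· ≥ ·)).SortedGE := (p.parts.pairwise_sort _).sortedGE
  have h : (ofRowLens _ hs).rowLens = p.parts.sort (· ≥ ·) :=
    rowLens_ofRowLens_eq_self fun x hx => p.parts_pos ((Multiset.mem_sort _).1 hx)
  have h' : ((ofRowLens _ hs).rowLens : Multiset ℕ) = p.parts := by rw [h, Multiset.sort_eq]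
  exact ⟨_, by rw [← sum_rowLens, ← Multiset.sum_coe, h', p.parts_sum], h'⟩

theorem gk_eq_numWalks {k i : ℕ} {p : Nat.Partition i} {μ : YoungDiagram}
    (h : (μ.rowLens : Multiset ℕ) = p.parts) : gk k i p = numWalks (2 * k) μ := by
  refine Nat.card_congr (Equiv.subtypeEquivRight fun w => ?_)
  rw [← h, IsSimplifiedVacillating, and_assoc]
  refine and_congr_right fun _ => and_congr Iff.rfl ⟨coe_rowLens_injective, fun e => by rw [e]⟩

theorem sum_partition_eq_weightedWalks (k i : ℕ) :
    ∑ p : Nat.Partition i, gk k i p * fSYT i p.parts = weightedWalks (2 * k) i := by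
  symm
  refine Finset.sum_bij (fun μ hμ => μ.toPartition (mem_level.1 hμ)) (fun _ _ => Finset.mem_univ _)
    (fun μ _ ν _ h => coe_rowLens_injective (congrArg Nat.Partition.parts h)) (fun p _ => ?_)
    (fun μ hμ => ?_)
  · obtain ⟨μ, hμ, h⟩ := exists_rowLens_eq p
    exact ⟨μ, mem_level.2 hμ, Nat.Partition.ext h⟩
  · rw [mem_level] at hμ
    subst hμ
    rw [gk_eq_numWalks (μ := μ) rfl, ← fSYT_rowLens]
    rfl

end YoungDiagram

/-- `g_k(μ) = 0` unless `|μ| ≤ k`, and for `n ≥ k` the sum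
`∑_μ g_k(μ) · f^μ · C(n, |μ|)` equals the number of `n`-restricted set
partitions of `{1,…,n+k}`. -/
theorem vacillating_count (k n : ℕ) (hkn : k ≤ n) :
    (∀ i : ℕ, ∀ p : Nat.Partition i, k < i → gk k i p = 0) ∧
    ∑ i ∈ Finset.range (k + 1), ∑ p : Nat.Partition i,
        gk k i p * fSYT i p.parts * n.choose i =
      Nat.card {P : Setoid (Fin (n + k)) // Restricted n k P} := by
  refine ⟨fun i p hi => ?_, ?_⟩
  · obtain ⟨μ, hμ, h⟩ := YoungDiagram.exists_rowLens_eq p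
    rw [YoungDiagram.gk_eq_numWalks h, YoungDiagram.numWalks_eq_zero (by omega)]
  · rw [← YoungDiagram.sum_weightedWalks_mul_choose]
    refine Finset.sum_congr rfl fun i _ => ?_
    rw [← Finset.sum_mul, YoungDiagram.sum_partition_eq_weightedWalks]
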